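/- Let (w_t)_{t≥1} be a sequence of positive reals with C_1(w) < ∞. Let (X,μ) be a probability space and for each t ≥ 1 let 𝒯_t be a finite family of at most 2^t measure-preserving transformations of (X,μ). Then for every f ∈ L^1(μ), lim_{t→∞} w_t·2^{-t}·Σ_{T∈𝒯_t} f(T x) = 0 for μ-almost every x ∈ X. -/

import Mathlib

open MeasureTheory Filter ENNReal

/-- `C₁(w) = sup_{y>0} Σ_{t≥1} w_t·[y < w_t < 2^t·y]`. -/
noncomputable def C1 (w : ℕ → ℝ) : ℝ≥0∞ :=
  ⨆ (y : ℝ) (_ : 0 < y), ∑' t : ℕ,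
    if 1 ≤ t ∧ y < w t ∧ w t < 2 ^ t * y then ENNReal.ofReal (w t) else 0

/-- The value `v` cut off above at `2 ^ t`, and replaced by `0` when `v ≤ 1`. -/
noncomputable def truncation (t : ℕ) (v : ℝ≥0∞) : ℝ≥0∞ :=
  if 1 < v then min v (2 ^ t) else 0

theorem measurable_truncation (t : ℕ) : Measurable (truncation t) :=
  Measurable.ite measurableSet_Ioi (measurable_id.min measurable_const) measurable_const

theorem le_one_add_truncation {t : ℕ} {v : ℝ≥0∞} (hv : v ≤ 2 ^ t) : v ≤ 1 + truncation t v := by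
  unfold truncation
  split_ifs with h
  · rw [min_eq_left hv]
    exact le_add_self
  · simpa using h

theorem measure_sum_comp_ge_le_lintegral_truncation {X : Type*} [MeasurableSpace X]
    {μ : Measure X} {t : ℕ} {S : Finset (X → X)} (hS : S.card ≤ 2 ^ t)
    (hmp : ∀ T ∈ S, MeasurePreserving T μ μ) {v : X → ℝ≥0∞} (hv : Measurable v) :
    μ {x | 2 * 2 ^ t ≤ ∑ T ∈ S, v (T x)} ≤ ∫⁻ x, truncation t (v x) ∂μ := by
  have hS' : (S.card : ℝ≥0∞) ≤ 2 ^ t := by exact_mod_cast hS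
  have hpos : (2 ^ t : ℝ≥0∞) ≠ 0 := by simp
  have hfin : (2 ^ t : ℝ≥0∞) ≠ ⊤ := by simp
  have hm : Measurable fun x => truncation t (v x) := (measurable_truncation t).comp hv
  have hsub : {x | 2 * 2 ^ t ≤ ∑ T ∈ S, v (T x)} ⊆
      {x | 2 ^ t ≤ ∑ T ∈ S, truncation t (v (T x))} := by
    intro x hx
    simp only [Set.mem_ofPred_eq] at hx ⊢
    by_cases hbig : ∃ T ∈ S, 2 ^ t < v (T x)
    · obtain ⟨T, hT, hlt⟩ := hbig
      have h1 : 1 < v (T x) := lt_of_le_of_lt (one_le_pow₀ one_le_two) hlt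
      calc (2 ^ t : ℝ≥0∞) = truncation t (v (T x)) := by
            rw [truncation, if_pos h1, min_eq_right hlt.le]
        _ ≤ _ := Finset.single_le_sum (f := fun T => truncation t (v (T x)))
            (fun _ _ => zero_le) hT
    · push Not at hbig
      have hle : 2 ^ t + 2 ^ t ≤ 2 ^ t + ∑ T ∈ S, truncation t (v (T x)) :=
        calc (2 ^ t + 2 ^ t : ℝ≥0∞) = 2 * 2 ^ t := (two_mul _).symm
          _ ≤ ∑ T ∈ S, v (T x) := hx
          _ ≤ ∑ T ∈ S, (1 + truncation t (v (T x))) :=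
            Finset.sum_le_sum fun T hT => le_one_add_truncation (hbig T hT)
          _ = S.card + ∑ T ∈ S, truncation t (v (T x)) := by simp [Finset.sum_add_distrib]
          _ ≤ _ := by gcongr
      exact (ENNReal.add_le_add_iff_left hfin).1 hle
  have hmeas : ∀ T ∈ S, Measurable fun x => truncation t (v (T x)) :=
    fun T hT => hm.comp (hmp T hT).measurable
  have hmul : 2 ^ t * μ {x | 2 * 2 ^ t ≤ ∑ T ∈ S, v (T x)} ≤
      2 ^ t * ∫⁻ x, truncation t (v x) ∂μ :=
    calc 2 ^ t * μ {x | 2 * 2 ^ t ≤ ∑ T ∈ S, v (T x)}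
        ≤ 2 ^ t * μ {x | 2 ^ t ≤ ∑ T ∈ S, truncation t (v (T x))} := by gcongr
      _ ≤ ∫⁻ x, ∑ T ∈ S, truncation t (v (T x)) ∂μ :=
        mul_meas_ge_le_lintegral (Finset.measurable_sum S hmeas) _
      _ = ∑ T ∈ S, ∫⁻ x, truncation t (v (T x)) ∂μ := lintegral_finsetSum S hmeas
      _ = ∑ T ∈ S, ∫⁻ x, truncation t (v x) ∂μ :=
        Finset.sum_congr rfl fun T hT => (hmp T hT).lintegral_comp hm
      _ = S.card * ∫⁻ x, truncation t (v x) ∂μ := by simp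
      _ ≤ _ := by gcongr
  exact (ENNReal.mul_le_mul_iff_right hpos hfin).1 hmul

theorem tsum_le_C1 (w : ℕ → ℝ) {y : ℝ} (hy : 0 < y) :
    (∑' t : ℕ, if 1 ≤ t ∧ y < w t ∧ w t < 2 ^ t * y then ENNReal.ofReal (w t) else 0) ≤ C1 w :=
  le_iSup₂_of_le y hy le_rfl

theorem ofReal_le_C1 {w : ℕ → ℝ} {t : ℕ} (ht : 2 ≤ t) (hw : 0 < w t) :
    ENNReal.ofReal (w t) ≤ C1 w := by
  have h4 : (4 : ℝ) ≤ 2 ^ t := by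
    calc (4 : ℝ) = 2 ^ 2 := by norm_num
      _ ≤ 2 ^ t := pow_le_pow_right₀ one_le_two ht
  refine le_trans ?_ (tsum_le_C1 w (half_pos hw))
  refine le_trans ?_ (ENNReal.le_tsum t)
  rw [if_pos ⟨by omega, by linarith, by nlinarith⟩]

theorem tsum_two_pow_ite_le (M : ℝ≥0∞) :
    (∑' t : ℕ, if (2 : ℝ≥0∞) ^ t ≤ M then (2 : ℝ≥0∞) ^ t else 0) ≤ 2 * M := by
  rw [ENNReal.tsum_eq_iSup_sum]
  refine iSup_le fun s => ?_
  rw [← Finset.sum_filter]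
  rcases (s.filter fun t => (2 : ℝ≥0∞) ^ t ≤ M).eq_empty_or_nonempty with h | h
  · simp [h]
  · set r := s.filter fun t => (2 : ℝ≥0∞) ^ t ≤ M
    have hmax : (2 : ℝ≥0∞) ^ r.max' h ≤ M := (Finset.mem_filter.1 (r.max'_mem h)).2
    have hsum : ∑ t ∈ r, 2 ^ t ≤ 2 ^ (r.max' h + 1) :=
      (Nat.geomSum_lt le_rfl fun k hk => Nat.lt_succ_of_le (r.le_max' k hk)).le
    calc ∑ t ∈ r, (2 : ℝ≥0∞) ^ t ≤ 2 ^ (r.max' h + 1) := by exact_mod_cast hsum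
      _ = 2 * 2 ^ r.max' h := pow_succ' _ _
      _ ≤ 2 * M := by gcongr

theorem tsum_truncation_le {w : ℕ → ℝ} (hw : ∀ t : ℕ, 1 ≤ t → 0 < w t) {a : ℝ} (ha : 0 ≤ a) :
    (∑' t : ℕ, if 2 ≤ t then truncation t (ENNReal.ofReal (w t * a)) else 0) ≤
      3 * C1 w * ENNReal.ofReal a := by
  rcases ha.eq_or_lt with rfl | ha
  · simp [truncation]
  have hterm : ∀ t : ℕ, (if 2 ≤ t then truncation t (ENNReal.ofReal (w t * a)) else 0) ≤
      (if 1 ≤ t ∧ a⁻¹ < w t ∧ w t < 2 ^ t * a⁻¹ then ENNReal.ofReal (w t) else 0) *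
        ENNReal.ofReal a +
      if (2 : ℝ≥0∞) ^ t ≤ C1 w * ENNReal.ofReal a then (2 : ℝ≥0∞) ^ t else 0 := by
    intro t
    by_cases h2 : 2 ≤ t
    · have hwt := hw t (by omega)
      rw [if_pos h2, truncation]
      by_cases h1 : 1 < ENNReal.ofReal (w t * a)
      · rw [if_pos h1]
        rw [ENNReal.one_lt_ofReal] at h1
        by_cases hlt : w t * a < 2 ^ t
        · refine le_add_right ?_
          rw [if_pos ⟨by omega, (inv_lt_iff_one_lt_mul₀ ha).2 h1, (lt_mul_inv_iff₀ ha).2 hlt⟩,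
            ← ENNReal.ofReal_mul hwt.le]
          exact min_le_left _ _
        · refine le_add_left ?_
          rw [if_pos]
          · exact min_le_right _ _
          · calc (2 : ℝ≥0∞) ^ t = ENNReal.ofReal (2 ^ t) := by
                  rw [ENNReal.ofReal_pow zero_le_two]; simp
              _ ≤ ENNReal.ofReal (w t * a) := ENNReal.ofReal_le_ofReal (not_lt.1 hlt)
              _ = ENNReal.ofReal (w t) * ENNReal.ofReal a := ENNReal.ofReal_mul hwt.le
              _ ≤ _ := by gcongr; exact ofReal_le_C1 h2 hwt
      · rw [if_neg h1]
        exact zero_le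
    · rw [if_neg h2]
      exact zero_le
  calc _ ≤ _ := ENNReal.tsum_le_tsum hterm
    _ ≤ C1 w * ENNReal.ofReal a + 2 * (C1 w * ENNReal.ofReal a) := by
      rw [ENNReal.tsum_add, ENNReal.tsum_mul_right]
      gcongr
      · exact tsum_le_C1 w (inv_pos.2 ha)
      · exact tsum_two_pow_ite_le _
    _ = 3 * C1 w * ENNReal.ofReal a := by ring

theorem ae_eventually_weighted_average_abs_lt {X : Type*} [MeasurableSpace X] {μ : Measure X}
    {w : ℕ → ℝ} (hw : ∀ t : ℕ, 1 ≤ t → 0 < w t) (hC1 : C1 w ≠ ⊤)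
    {𝒯 : ℕ → Finset (X → X)}
    (hcard : ∀ t : ℕ, 1 ≤ t → (𝒯 t).card ≤ 2 ^ t)
    (hmp : ∀ t : ℕ, 1 ≤ t → ∀ T ∈ 𝒯 t, MeasurePreserving T μ μ)
    {g : X → ℝ} (hgm : Measurable g) (hg : Integrable g μ) {ε : ℝ} (hε : 0 < ε) :
    ∀ᵐ x ∂μ, ∀ᶠ t in atTop, w t * (2 ^ t : ℝ)⁻¹ * ∑ T ∈ 𝒯 t, |g (T x)| < ε := by
  have hv : ∀ t, Measurable fun x => ENNReal.ofReal (w t * (2 / ε * |g x|)) := fun t => by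
    fun_prop
  have hsum : ∑' t, μ {x | 2 ≤ t ∧
      2 * 2 ^ t ≤ ∑ T ∈ 𝒯 t, ENNReal.ofReal (w t * (2 / ε * |g (T x)|))} ≠ ⊤ := by
    refine ne_top_of_le_ne_top (b := 3 * C1 w * ∫⁻ x, ENNReal.ofReal (2 / ε * |g x|) ∂μ) ?_ ?_
    · exact ENNReal.mul_ne_top (ENNReal.mul_ne_top (by simp) hC1)
        (hg.abs.const_mul (2 / ε)).lintegral_lt_top.ne
    calc _ ≤ ∑' t, ∫⁻ x, (if 2 ≤ t then
            truncation t (ENNReal.ofReal (w t * (2 / ε * |g x|))) else 0) ∂μ := by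
          refine ENNReal.tsum_le_tsum fun t => ?_
          by_cases h2 : 2 ≤ t
          · simpa [h2] using measure_sum_comp_ge_le_lintegral_truncation
              (hcard t (by omega)) (hmp t (by omega)) (hv t)
          · simp [h2]
      _ = ∫⁻ x, ∑' t, (if 2 ≤ t then
            truncation t (ENNReal.ofReal (w t * (2 / ε * |g x|))) else 0) ∂μ := by
          refine (lintegral_tsum fun t => ?_).symm
          split_ifs
          · exact ((measurable_truncation t).comp (hv t)).aemeasurable
          · exact aemeasurable_const
      _ ≤ ∫⁻ x, 3 * C1 w * ENNReal.ofReal (2 / ε * |g x|) ∂μ :=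
          lintegral_mono fun x => tsum_truncation_le hw (by positivity)
      _ = _ := lintegral_const_mul _ (by fun_prop)
  filter_upwards [ae_eventually_notMem hsum] with x hx
  filter_upwards [hx, eventually_ge_atTop 2] with t ht h2
  have hwt := hw t (by omega)
  simp only [h2, true_and, not_le] at ht
  rw [← ENNReal.ofReal_sum_of_nonneg fun T _ => by positivity,
    show (2 * 2 ^ t : ℝ≥0∞) = ENNReal.ofReal (2 * 2 ^ t) by
      rw [ENNReal.ofReal_mul zero_le_two, ENNReal.ofReal_pow zero_le_two]; simp,
    ENNReal.ofReal_lt_ofReal_iff (by positivity), ← Finset.mul_sum, ← Finset.mul_sum] at ht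
  have hpow : (0 : ℝ) < 2 ^ t := by positivity
  calc w t * (2 ^ t : ℝ)⁻¹ * ∑ T ∈ 𝒯 t, |g (T x)|
      = (w t * (2 / ε * ∑ T ∈ 𝒯 t, |g (T x)|)) * (ε / (2 * 2 ^ t)) := by field_simp
    _ < 2 * 2 ^ t * (ε / (2 * 2 ^ t)) := by gcongr
    _ = ε := by field_simp

theorem stmt2 {X : Type*} [MeasurableSpace X] (μ : Measure X) [IsProbabilityMeasure μ]
    (w : ℕ → ℝ) (hw : ∀ t : ℕ, 1 ≤ t → 0 < w t) (hC1 : C1 w ≠ ⊤)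
    (𝒯 : ℕ → Finset (X → X))
    (hcard : ∀ t : ℕ, 1 ≤ t → (𝒯 t).card ≤ 2 ^ t)
    (hmp : ∀ t : ℕ, 1 ≤ t → ∀ T ∈ 𝒯 t, MeasurePreserving T μ μ)
    (f : X → ℝ) (hf : Integrable f μ) :
    ∀ᵐ x ∂μ, Tendsto
      (fun t : ℕ => w t * (2 ^ t : ℝ)⁻¹ * ∑ T ∈ 𝒯 t, f (T x))
      atTop (nhds 0) := by
  obtain ⟨g, hgm, hfg⟩ := hf.1.aemeasurable
  have hg : Integrable g μ := hf.congr hfg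
  have heq : ∀ᵐ x ∂μ, ∀ t : ℕ, 1 ≤ t → ∀ T ∈ 𝒯 t, f (T x) = g (T x) := by
    refine ae_all_iff.2 fun t => ?_
    by_cases ht : 1 ≤ t
    · have h := (ae_ball_iff (𝒯 t).countable_toSet).2 fun T hT =>
        (hmp t ht T hT).quasiMeasurePreserving.ae hfg
      filter_upwards [h] with x hx _ T hT using hx T hT
    · simp [ht]
  have hlt : ∀ᵐ x ∂μ, ∀ n : ℕ, ∀ᶠ t in atTop,
      w t * (2 ^ t : ℝ)⁻¹ * ∑ T ∈ 𝒯 t, |g (T x)| < 1 / ((n : ℝ) + 1) :=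
    ae_all_iff.2 fun n => ae_eventually_weighted_average_abs_lt hw hC1 hcard hmp hgm hg
      Nat.one_div_pos_of_nat
  filter_upwards [heq, hlt] with x hx hxlt
  rw [Metric.tendsto_nhds]
  intro ε hε
  obtain ⟨n, hn⟩ := exists_nat_one_div_lt hε
  filter_upwards [hxlt n, eventually_ge_atTop 1] with t ht h1
  have hwt := hw t h1
  rw [Real.dist_eq, sub_zero, Finset.sum_congr rfl (hx t h1), abs_mul,
    abs_of_nonneg (by positivity : 0 ≤ w t * (2 ^ t : ℝ)⁻¹)]
  refine lt_of_le_of_lt ?_ (ht.trans hn)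
  gcongr
  exact Finset.abs_sum_le_sum_abs _ _
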